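/- arXiv:1507.06583 — 2 statements merged into one kernel-verified Lean document; each statement's English description precedes it below -/
import Mathlib

section
/- For n ≥ 3, the critical group of the n×n rook's graph R_n is isomorphic to (Z/2n)^{(n-2)²+1} ⊕ (Z/2n²)^{2(n-2)}. -/
/-- The adjacency matrix (over `ℤ`) of the `n × n` rook's graph: vertices are
squares of an `n × n` grid, adjacent when distinct and in the same row or column. -/
def rookAdj (n : ℕ) : Matrix (Fin n × Fin n) (Fin n × Fin n) ℤ :=
  fun u v => if u ≠ v ∧ (u.1 = v.1 ∨ u.2 = v.2) then 1 else 0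

/-- The Laplacian matrix `L = D - A` of the rook's graph, where `D` is the diagonal
matrix of vertex degrees. -/
def rookLap (n : ℕ) : Matrix (Fin n × Fin n) (Fin n × Fin n) ℤ :=
  Matrix.diagonal (fun u => ∑ v, rookAdj n u v) - rookAdj n

/-- The adjacency matrix (over `ℤ`) of the complement of the rook's graph. -/
def rookcAdj (n : ℕ) : Matrix (Fin n × Fin n) (Fin n × Fin n) ℤ :=
  fun u v => if u ≠ v ∧ u.1 ≠ v.1 ∧ u.2 ≠ v.2 then 1 else 0

/-- The Laplacian matrix of the complement of the rook's graph. -/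
def rookcLap (n : ℕ) : Matrix (Fin n × Fin n) (Fin n × Fin n) ℤ :=
  Matrix.diagonal (fun u => ∑ v, rookcAdj n u v) - rookcAdj n

/-- The relations `2n • E i j = ∑ j', E i j' + ∑ i', E i' j` which present the cokernel of the
Laplacian of the rook's graph. -/
def RookRelations {I T : Type*} [Fintype I] [AddCommGroup T] (E : I → I → T) : Prop :=
  ∀ i j, (2 * (Fintype.card I : ℤ)) • E i j = ∑ j', E i j' + ∑ i', E i' j

namespace RookRelations

section Laplacian

theorem rookAdj_apply (n : ℕ) (u v : Fin n × Fin n) :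
    rookAdj n u v = (if u.1 = v.1 then 1 else 0) + (if u.2 = v.2 then 1 else 0)
      - 2 * (if u = v then 1 else 0) := by
  obtain ⟨a, b⟩ := u
  obtain ⟨c, d⟩ := v
  by_cases h1 : a = c <;> by_cases h2 : b = d <;> simp [rookAdj, h1, h2]

theorem sum_rookAdj (n : ℕ) (u : Fin n × Fin n) : ∑ v, rookAdj n u v = 2 * (n : ℤ) - 2 := by
  simp only [rookAdj_apply, Finset.sum_sub_distrib, Finset.sum_add_distrib, ← Finset.mul_sum,
    Fintype.sum_prod_type, Finset.sum_ite_eq, Finset.mem_univ, if_true]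
  rw [Finset.sum_comm]
  simp
  ring

theorem rookLap_apply (n : ℕ) (u v : Fin n × Fin n) :
    rookLap n u v = (if u = v then 2 * (n : ℤ) else 0)
      - (if u.1 = v.1 then 1 else 0) - (if u.2 = v.2 then 1 else 0) := by
  rw [rookLap, Matrix.sub_apply, Matrix.diagonal_apply, sum_rookAdj, rookAdj_apply]
  split_ifs <;> ring

theorem linearCombination_rookLap {T : Type*} [AddCommGroup T] (n : ℕ)
    (E : Fin n → Fin n → T) (v : Fin n × Fin n) :
    ∑ u, rookLap n u v • E u.1 u.2
      = (2 * (n : ℤ)) • E v.1 v.2 - (∑ j, E v.1 j + ∑ i, E i v.2) := by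
  obtain ⟨a, b⟩ := v
  simp [rookLap_apply, sub_smul, add_smul, Finset.sum_sub_distrib, Finset.sum_add_distrib, ite_smul, Fintype.sum_prod_type,
    Prod.ext_iff, ite_and, sub_sub]

end Laplacian

section Cokernel

variable {n : ℕ}

/-- The class of a vertex in the cokernel of the Laplacian. -/
def vertexClass (n : ℕ) (i j : Fin n) :
    (Fin n × Fin n → ℤ) ⧸ LinearMap.range (rookLap n).mulVecLin :=
  Submodule.Quotient.mk (Pi.single (i, j) 1)

theorem vertexClass_relations (n : ℕ) : RookRelations (vertexClass n) := by
  intro i j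
  rw [Fintype.card_fin, ← sub_eq_zero, ← linearCombination_rookLap n (vertexClass n) (i, j)]
  have h : ∑ u, rookLap n u (i, j) • vertexClass n u.1 u.2
      = Submodule.Quotient.mk ((rookLap n).mulVecLin (Pi.single (i, j) 1)) := by
    have h2 : (rookLap n).mulVecLin (Pi.single (i, j) 1)
        = ∑ u, rookLap n u (i, j) • (Pi.single u 1 : Fin n × Fin n → ℤ) := by
      ext w
      simp [Matrix.mulVec_single, Finset.sum_apply, Pi.single_apply]
    rw [h2, ← Submodule.mkQ_apply, map_sum]
    exact Finset.sum_congr rfl fun u _ => by rw [map_smul]; rfl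
  rw [h, Submodule.Quotient.mk_eq_zero]
  exact LinearMap.mem_range_self _ _

/-- The homomorphism out of the cokernel of the Laplacian determined by a family satisfying the
relations. -/
def lift {T : Type*} [AddCommGroup T] (E : Fin n → Fin n → T) (hE : RookRelations E) :
    ((Fin n × Fin n → ℤ) ⧸ LinearMap.range (rookLap n).mulVecLin) →ₗ[ℤ] T :=
  Submodule.liftQ _ (Fintype.linearCombination ℤ (fun u : Fin n × Fin n => E u.1 u.2)) <| by
    rw [LinearMap.range_le_ker_iff]
    refine LinearMap.pi_ext' fun v => LinearMap.ext_ring ?_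
    have h := linearCombination_rookLap n E v
    have h2 := hE v.1 v.2
    rw [Fintype.card_fin] at h2
    rw [h2, sub_self] at h
    simpa [Fintype.linearCombination_apply, Matrix.mulVec_single] using h

theorem lift_vertexClass {T : Type*} [AddCommGroup T] (E : Fin n → Fin n → T)
    (hE : RookRelations E) (i j : Fin n) : lift E hE (vertexClass n i j) = E i j := by
  rw [lift, vertexClass, ← Submodule.mkQ_apply, Submodule.mkQ_apply, Submodule.liftQ_apply]
  simp

theorem hom_ext {T : Type*} [AddCommGroup T]
    {f g : ((Fin n × Fin n → ℤ) ⧸ LinearMap.range (rookLap n).mulVecLin) →ₗ[ℤ] T}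
    (h : ∀ i j, f (vertexClass n i j) = g (vertexClass n i j)) : f = g :=
  Submodule.linearMap_qext _ <| LinearMap.pi_ext' fun v => LinearMap.ext_ring (h v.1 v.2)

end Cokernel

section Coordinates

variable {T : Type*} [AddCommGroup T] {k : ℕ}

/-- If differences along rows, along columns, and mixed differences satisfy the defining
relations, the resulting family satisfies the relations of the rook's graph. -/
theorem of_differences {I : Type*} [Fintype I] (e : T) (X Y : I → T) (U : I → I → T)
    (hX : ∀ i, (Fintype.card I : ℤ) • X i = ∑ j, U i j)
    (hY : ∀ j, (Fintype.card I : ℤ) • Y j = ∑ i, U i j)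
    (hU : ∀ i j, (2 * (Fintype.card I : ℤ)) • U i j = 0) (hXY : ∑ i, X i + ∑ j, Y j = 0) :
    RookRelations (fun i j => e + X i + Y j + U i j) := by
  intro i j
  simp only [Finset.sum_add_distrib, ← hX, ← hY, Finset.sum_const, Finset.card_univ,
    ← natCast_zsmul]
  linear_combination (norm := module) hU i j - hXY

/-- Row differences in terms of free coordinates. -/
def rowDiff (s : T) (x : Fin k → T) : Option (Option (Fin k)) → T
  | none => 0
  | some none => s - ∑ i, x i
  | some (some i) => x i

/-- Mixed differences in terms of free coordinates. -/
def mixedDiff (s : T) (x y : Fin k → T) (u : Fin k → Fin k → T) :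
    Option (Option (Fin k)) → Option (Option (Fin k)) → T
  | none, _ => 0
  | some _, none => 0
  | some (some i), some (some j) => u i j
  | some (some i), some none => ((k : ℤ) + 2) • x i - ∑ j, u i j
  | some none, some (some j) => ((k : ℤ) + 2) • y j - ∑ i, u i j
  | some none, some none =>
      ((k : ℤ) + 2) • (s - ∑ i, x i) - ((k : ℤ) + 2) • ∑ j, y j + ∑ i, ∑ j, u i j

/-- The family with given free coordinates. -/
def ofCoords (e s : T) (x y : Fin k → T) (u : Fin k → Fin k → T)
    (i j : Option (Option (Fin k))) : T :=
  e + rowDiff s x i + rowDiff (-s) y j + mixedDiff s x y u i j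

theorem ofCoords_relations (e s : T) (x y : Fin k → T) (u : Fin k → Fin k → T)
    (hs : (2 * ((k : ℤ) + 2)) • s = 0) (hx : ∀ i, (2 * ((k : ℤ) + 2) ^ 2) • x i = 0)
    (hy : ∀ i, (2 * ((k : ℤ) + 2) ^ 2) • y i = 0)
    (hu : ∀ i j, (2 * ((k : ℤ) + 2)) • u i j = 0) :
    RookRelations (ofCoords e s x y u) := by
  have hc : (Fintype.card (Option (Option (Fin k))) : ℤ) = (k : ℤ) + 2 := by
    simp; ring
  have hx' : (2 * ((k : ℤ) + 2) ^ 2) • ∑ i, x i = 0 := by simp [Finset.smul_sum, hx]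
  have hy' : (2 * ((k : ℤ) + 2) ^ 2) • ∑ i, y i = 0 := by simp [Finset.smul_sum, hy]
  have hu1 : ∀ i, (2 * ((k : ℤ) + 2)) • ∑ j, u i j = 0 := by simp [Finset.smul_sum, hu]
  have hu2 : ∀ j, (2 * ((k : ℤ) + 2)) • ∑ i, u i j = 0 := by simp [Finset.smul_sum, hu]
  have hu3 : (2 * ((k : ℤ) + 2)) • ∑ i, ∑ j, u i j = 0 := by
    rw [Finset.smul_sum]; simp [hu1]
  refine of_differences e _ _ _ ?_ ?_ ?_ ?_
  · rw [hc]
    rintro (_ | _ | i)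
    · simp [rowDiff, mixedDiff]
    · simp only [rowDiff, mixedDiff, Fintype.sum_option, Finset.sum_sub_distrib,
        ← Finset.smul_sum]
      rw [Finset.sum_comm]
      module
    · simp only [rowDiff, mixedDiff, Fintype.sum_option]
      module
  · rw [hc]
    rintro (_ | _ | i)
    · simp [rowDiff, mixedDiff, Fintype.sum_option]
    · simp only [rowDiff, mixedDiff, Fintype.sum_option, Finset.sum_sub_distrib,
        ← Finset.smul_sum]
      linear_combination (norm := module) -hs
    · simp only [rowDiff, mixedDiff, Fintype.sum_option]
      module
  · rw [hc]
    rintro (_ | _ | i) (_ | _ | j)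
    · simp [mixedDiff]
    · simp [mixedDiff]
    · simp [mixedDiff]
    · simp [mixedDiff]
    · simp only [mixedDiff]
      linear_combination (norm := module) ((k : ℤ) + 2) • hs - hx' - hy' + hu3
    · simp only [mixedDiff]
      linear_combination (norm := module) hy j - hu2 j
    · simp [mixedDiff]
    · simp only [mixedDiff]
      linear_combination (norm := module) hx i - hu1 i
    · exact hu i j
  · simp only [rowDiff, Fintype.sum_option]
    module

variable {E : Option (Option (Fin k)) → Option (Option (Fin k)) → T}

theorem smul_eq (hE : RookRelations E) (i j : Option (Option (Fin k))) :
    (2 * ((k : ℤ) + 2)) • E i j = ∑ j', E i j' + ∑ i', E i' j := by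
  have hc : (Fintype.card (Option (Option (Fin k))) : ℤ) = (k : ℤ) + 2 := by
    simp; ring
  rw [← hc]
  exact hE i j

theorem smul_mixed (hE : RookRelations E) (i j i' j' : Option (Option (Fin k))) :
    (2 * ((k : ℤ) + 2)) • (E i j - E i j' - E i' j + E i' j') = 0 := by
  linear_combination (norm := module)
    hE.smul_eq i j - hE.smul_eq i j' - hE.smul_eq i' j + hE.smul_eq i' j'

theorem smul_row (hE : RookRelations E) (i i' j : Option (Option (Fin k))) :
    ((k : ℤ) + 2) • (E i j - E i' j) = ∑ l, (E i l - E i j - E i' l + E i' j) := by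
  simp only [Finset.sum_add_distrib, Finset.sum_sub_distrib, Finset.sum_const, Finset.card_univ,
    ← natCast_zsmul, Fintype.card_option, Fintype.card_fin]
  push_cast
  linear_combination (norm := module) hE.smul_eq i j - hE.smul_eq i' j

theorem transpose (hE : RookRelations E) : RookRelations (fun i j => E j i) := fun i j => by
  rw [hE j i, add_comm]

theorem sum_differences (hE : RookRelations E) (i j : Option (Option (Fin k))) :
    ∑ l, (E l j - E i j) + ∑ l, (E i l - E i j) = 0 := by
  simp only [Finset.sum_sub_distrib, Finset.sum_const, Finset.card_univ,
    ← natCast_zsmul, Fintype.card_option, Fintype.card_fin]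
  push_cast
  linear_combination (norm := module) -hE.smul_eq i j

theorem smul_row_sq (hE : RookRelations E) (i i' j : Option (Option (Fin k))) :
    (2 * ((k : ℤ) + 2) ^ 2) • (E i j - E i' j) = 0 := by
  have h := congrArg (fun t => (2 * ((k : ℤ) + 2)) • t) (hE.smul_row i i' j)
  simp only [Finset.smul_sum, hE.smul_mixed, Finset.sum_const_zero] at h
  linear_combination (norm := module) h

theorem smul_sum_row (hE : RookRelations E) (i j : Option (Option (Fin k))) :
    (2 * ((k : ℤ) + 2)) • ∑ l, (E l j - E i j) = 0 := by
  have h1 : ((k : ℤ) + 2) • ∑ l, (E l j - E i j)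
      = ∑ l, ∑ m, (E l m - E l j - E i m + E i j) := by
    rw [Finset.smul_sum]
    exact Finset.sum_congr rfl fun l _ => hE.smul_row l i j
  have h2 : ((k : ℤ) + 2) • ∑ m, (E i m - E i j)
      = ∑ l, ∑ m, (E l m - E l j - E i m + E i j) := by
    rw [Finset.smul_sum, Finset.sum_comm]
    refine Finset.sum_congr rfl fun m _ => (hE.transpose.smul_row m j i).trans ?_
    exact Finset.sum_congr rfl fun l _ => by abel
  linear_combination (norm := module) h1 - h2 + ((k : ℤ) + 2) • hE.sum_differences i j

/-- A family satisfying the relations is recovered from its free coordinates. -/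
theorem eq_ofCoords (hE : RookRelations E) :
    ofCoords (E none none) (∑ l, (E l none - E none none))
      (fun i => E (some (some i)) none - E none none)
      (fun j => E none (some (some j)) - E none none)
      (fun i j => E (some (some i)) (some (some j)) - E (some (some i)) none
        - E none (some (some j)) + E none none) = E := by
  have hr : ∀ i, _ := fun i => hE.smul_row i none none
  have hc : ∀ j, _ := fun j => hE.transpose.smul_row j none none
  have hs := hE.sum_differences none none
  funext i j
  rcases i with _ | _ | i <;> rcases j with _ | _ | j <;>
    simp only [ofCoords, rowDiff, mixedDiff]
  · module
  · simp only [Fintype.sum_option] at hs ⊢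
    linear_combination (norm := module) -hs
  · module
  · simp only [Fintype.sum_option]
    module
  · have hrl := hr (some none)
    have hcs : ∀ j : Fin k, _ := fun j => hc (some (some j))
    have hsum := Finset.sum_congr (rfl : (Finset.univ : Finset (Fin k)) = _)
      fun j _ => hcs j
    simp only [Fintype.sum_option, Finset.sum_add_distrib, Finset.sum_sub_distrib,
      ← Finset.smul_sum, Finset.sum_const, Finset.card_univ, ← natCast_zsmul, Fintype.card_fin]
      at hs hrl hsum ⊢
    rw [Finset.sum_comm] at hsum
    simp only [Fintype.card_option, Fintype.card_fin] at hs hrl hsum ⊢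
    push_cast at hs hrl hsum ⊢
    linear_combination (norm := module) hrl - hs - hsum
  · have h := hc (some (some j))
    simp only [Fintype.sum_option, Finset.sum_add_distrib, Finset.sum_sub_distrib] at h hs ⊢
    linear_combination (norm := module) h
  · module
  · have h := hr (some (some i))
    simp only [Fintype.sum_option, Finset.sum_add_distrib, Finset.sum_sub_distrib] at h hs ⊢
    linear_combination (norm := module) h - hs
  · module

theorem sum_ofCoords_sub (e s : T) (x y : Fin k → T) (u : Fin k → Fin k → T) :
    ∑ l, (ofCoords e s x y u l none - ofCoords e s x y u none none) = s := by
  simp only [Fintype.sum_option, ofCoords, rowDiff, mixedDiff]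
  simp

theorem map_ofCoords {S : Type*} [AddCommGroup S] (f : T →+ S) (e s : T) (x y : Fin k → T)
    (u : Fin k → Fin k → T) (i j : Option (Option (Fin k))) :
    f (ofCoords e s x y u i j) = ofCoords (f e) (f s) (fun i => f (x i)) (fun i => f (y i))
      (fun i j => f (u i j)) i j := by
  rcases i with _ | _ | i <;> rcases j with _ | _ | j <;>
    simp [ofCoords, rowDiff, mixedDiff, map_sum, map_zsmul]

theorem reindex {I J : Type*} [Fintype I] [Fintype J] {F : J → J → T} (hF : RookRelations F)
    (σ : I ≃ J) : RookRelations (fun i j => F (σ i) (σ j)) := fun i j => by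
  rw [Fintype.card_congr σ, hF, Equiv.sum_comp σ (fun l => F (σ i) l),
    Equiv.sum_comp σ (fun l => F l (σ j))]

end Coordinates

section CyclicSum

/-- The homomorphism from a power of `ZMod m` determined by a family of elements killed by `m`. -/
def piZModLift {ι T : Type*} [Fintype ι] [AddCommGroup T] (m : ℕ) (f : ι → T)
    (hf : ∀ i, (m : ℤ) • f i = 0) : (ι → ZMod m) →+ T :=
  ∑ i, (ZMod.lift m ⟨zmultiplesHom T (f i), by simpa using hf i⟩).comp
    (Pi.evalAddMonoidHom (fun _ => ZMod m) i)

theorem piZModLift_single {ι T : Type*} [Fintype ι] [DecidableEq ι] [AddCommGroup T] (m : ℕ)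
    (f : ι → T) (hf : ∀ i, (m : ℤ) • f i = 0) (i : ι) :
    piZModLift m f hf (Pi.single i 1) = f i := by
  rw [piZModLift, AddMonoidHom.finsetSum_apply, Finset.sum_eq_single i]
  · have h : (1 : ZMod m) = ((1 : ℤ) : ZMod m) := by simp
    simp only [AddMonoidHom.comp_apply, Pi.evalAddMonoidHom_apply, Pi.single_eq_same]
    rw [h, ZMod.lift_coe]
    simp
  · intro j _ hj
    simp [Pi.single_eq_of_ne hj]
  · simp

theorem pi_zmod_hom_ext {ι T : Type*} [Finite ι] [DecidableEq ι] [AddCommGroup T] {m : ℕ}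
    {f g : (ι → ZMod m) →+ T} (h : ∀ i, f (Pi.single i 1) = g (Pi.single i 1)) : f = g := by
  refine AddMonoidHom.functions_ext' _ _ _ fun i => ?_
  refine (AddMonoidHom.cancel_right (f := Int.castAddHom (ZMod m))
    ZMod.intCast_surjective).1 (AddMonoidHom.ext_int ?_)
  simpa using h i

end CyclicSum

section Isomorphism

/-- A free abelian group of rank one together with the cyclic summands of the critical group of
the rook's graph of side `k + 2`. -/
abbrev CyclicModel (k : ℕ) : Type :=
  ℤ × ((Option (Fin k × Fin k) → ZMod (2 * (k + 2))) ×
    (Fin k ⊕ Fin k → ZMod (2 * (k + 2) ^ 2)))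

variable {k : ℕ}

namespace CyclicModel

/-- Generators of order `2 * (k + 2)`. -/
def small (i : Option (Fin k × Fin k)) : CyclicModel k := (0, Pi.single i 1, 0)

/-- Generators of order `2 * (k + 2) ^ 2`. -/
def large (i : Fin k ⊕ Fin k) : CyclicModel k := (0, 0, Pi.single i 1)

theorem smul_small (i : Option (Fin k × Fin k)) :
    (2 * ((k : ℤ) + 2)) • small (k := k) i = 0 := by
  have h : ((2 * ((k : ℤ) + 2) : ℤ) : ZMod (2 * (k + 2))) = 0 := by
    exact_mod_cast ZMod.natCast_self (2 * (k + 2))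
  simp only [small, Prod.smul_mk, smul_zero, ← Pi.single_smul, zsmul_one, h, Pi.single_zero]
  rfl

theorem smul_large (i : Fin k ⊕ Fin k) :
    (2 * ((k : ℤ) + 2) ^ 2) • large (k := k) i = 0 := by
  have h : ((2 * ((k : ℤ) + 2) ^ 2 : ℤ) : ZMod (2 * (k + 2) ^ 2)) = 0 := by
    exact_mod_cast ZMod.natCast_self (2 * (k + 2) ^ 2)
  simp only [large, Prod.smul_mk, smul_zero, ← Pi.single_smul, zsmul_one, h, Pi.single_zero]
  rfl

theorem hom_ext {T : Type*} [AddCommGroup T] {f g : CyclicModel k →+ T}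
    (h₀ : f (1, 0) = g (1, 0)) (h₁ : ∀ i, f (small i) = g (small i))
    (h₂ : ∀ i, f (large i) = g (large i)) : f = g := by
  have H₀ : f.comp (AddMonoidHom.inl _ _) = g.comp (AddMonoidHom.inl _ _) :=
    AddMonoidHom.ext_int h₀
  have H₁ : (f.comp (AddMonoidHom.inr _ _)).comp (AddMonoidHom.inl _ _)
      = (g.comp (AddMonoidHom.inr _ _)).comp (AddMonoidHom.inl _ _) := pi_zmod_hom_ext h₁
  have H₂ : (f.comp (AddMonoidHom.inr _ _)).comp (AddMonoidHom.inr _ _)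
      = (g.comp (AddMonoidHom.inr _ _)).comp (AddMonoidHom.inr _ _) := pi_zmod_hom_ext h₂
  ext ⟨a, b, c⟩
  have hd : ((a, b, c) : CyclicModel k) = (a, 0) + ((0, b, 0) + (0, 0, c)) := by simp
  rw [hd, map_add, map_add, map_add, map_add]
  exact congrArg₂ _ (DFunLike.congr_fun H₀ a)
    (congrArg₂ _ (DFunLike.congr_fun H₁ b) (DFunLike.congr_fun H₂ c))

/-- The homomorphism determined by the images of the generators. -/
def lift {T : Type*} [AddCommGroup T] (e : T) (a : Option (Fin k × Fin k) → T)
    (b : Fin k ⊕ Fin k → T) (ha : ∀ i, (2 * ((k : ℤ) + 2)) • a i = 0)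
    (hb : ∀ i, (2 * ((k : ℤ) + 2) ^ 2) • b i = 0) : CyclicModel k →+ T :=
  (zmultiplesHom T e).coprod
    ((piZModLift _ a (by exact_mod_cast ha)).coprod (piZModLift _ b (by exact_mod_cast hb)))

section

variable {T : Type*} [AddCommGroup T] {e : T} {a : Option (Fin k × Fin k) → T}
    {b : Fin k ⊕ Fin k → T} {ha : ∀ i, (2 * ((k : ℤ) + 2)) • a i = 0}
    {hb : ∀ i, (2 * ((k : ℤ) + 2) ^ 2) • b i = 0}

theorem lift_one : lift e a b ha hb (1, 0) = e := by
  simp [lift]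

theorem lift_small (i : Option (Fin k × Fin k)) : lift e a b ha hb (small i) = a i := by
  simp [lift, small, piZModLift_single]

theorem lift_large (i : Fin k ⊕ Fin k) : lift e a b ha hb (large i) = b i := by
  simp [lift, large, piZModLift_single]

end

/-- The family in the cyclic model whose free coordinates are the generators. -/
def family (k : ℕ) : Option (Option (Fin k)) → Option (Option (Fin k)) → CyclicModel k :=
  ofCoords (1, 0) (small none) (fun i => large (.inl i)) (fun i => large (.inr i))
    (fun i j => small (some (i, j)))

theorem family_relations (k : ℕ) : RookRelations (family k) :=
  ofCoords_relations _ _ _ _ _ (smul_small _) (fun _ => smul_large _) (fun _ => smul_large _)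
    (fun _ _ => smul_small _)

end CyclicModel

open CyclicModel in
/-- The cokernel of the Laplacian of the rook's graph. -/
theorem nonempty_cokernel_equiv (k : ℕ) :
    Nonempty (((Fin (k + 2) × Fin (k + 2) → ℤ) ⧸ LinearMap.range (rookLap (k + 2)).mulVecLin)
      ≃+ CyclicModel k) := by
  have σ : Fin (k + 2) ≃ Option (Option (Fin k)) := Fintype.equivOfCardEq (by simp)
  let V := fun i j => vertexClass (k + 2) (σ.symm i) (σ.symm j)
  have hV : RookRelations V := (vertexClass_relations (k + 2)).reindex σ.symm
  let φ := RookRelations.lift _ ((family_relations k).reindex σ)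
  have hφ : ∀ i j, φ (V i j) = family k i j := fun i j => by
    simp [φ, V, lift_vertexClass]
  let ψ : CyclicModel k →+ _ := CyclicModel.lift (V none none)
    (fun o => o.elim (∑ l, (V l none - V none none)) fun p =>
      V (some (some p.1)) (some (some p.2)) - V (some (some p.1)) none
        - V none (some (some p.2)) + V none none)
    (Sum.elim (fun i => V (some (some i)) none - V none none)
      (fun j => V none (some (some j)) - V none none))
    (by
      rintro (_ | ⟨i, j⟩)
      · exact hV.smul_sum_row none none
      · exact hV.smul_mixed _ _ _ _)
    (by
      rintro (i | j)
      · exact hV.smul_row_sq _ _ _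
      · exact hV.transpose.smul_row_sq _ _ _)
  have hψ : ∀ i j, ψ (family k i j) = V i j := fun i j => by
    rw [family, map_ofCoords]
    simp only [ψ, lift_one, lift_small, lift_large, Option.elim_none, Option.elim_some,
      Sum.elim_inl, Sum.elim_inr]
    exact congrFun₂ hV.eq_ofCoords i j
  have h₁ : ψ.toIntLinearMap ∘ₗ φ = LinearMap.id := RookRelations.hom_ext fun i j => by
    have h := hψ (σ i) (σ j)
    rw [← hφ] at h
    simpa [V] using h
  have h₂ : φ.toAddMonoidHom.comp ψ = AddMonoidHom.id _ := by
    refine CyclicModel.hom_ext ?_ ?_ ?_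
    · simp [ψ, lift_one, hφ, family, ofCoords, rowDiff, mixedDiff]
    · rintro (_ | ⟨i, j⟩)
      · simp only [ψ, lift_small, Option.elim_none, map_sum, map_sub, LinearMap.toAddMonoidHom_coe,
          AddMonoidHom.comp_apply, hφ, AddMonoidHom.id_apply]
        exact sum_ofCoords_sub _ _ _ _ _
      · simp [ψ, lift_small, hφ, family, ofCoords, rowDiff, mixedDiff]
        abel
    · rintro (i | j)
      · simp [ψ, lift_large, hφ, family, ofCoords, rowDiff, mixedDiff]
      · simp [ψ, lift_large, hφ, family, ofCoords, rowDiff, mixedDiff]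
  exact ⟨{ toFun := φ
           invFun := ψ
           left_inv := fun x => LinearMap.congr_fun h₁ x
           right_inv := fun x => DFunLike.congr_fun h₂ x
           map_add' := map_add φ }⟩

/-- The torsion subgroup of a group isomorphic to `ℤ × Q`, with `Q` torsion, is isomorphic
to `Q`. -/
theorem nonempty_torsion_equiv {G Q : Type*} [AddCommGroup G] [AddCommGroup Q]
    (hQ : IsAddTorsion Q) (e : G ≃+ ℤ × Q) :
    Nonempty (AddCommGroup.torsion G ≃+ Q) := by
  let f : Q →+ AddCommGroup.torsion G :=
    (e.symm.toAddMonoidHom.comp (AddMonoidHom.inr ℤ Q)).codRestrict _ fun q =>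
      AddMonoidHom.isOfFinAddOrder _ (hQ q)
  refine ⟨(AddEquiv.ofBijective f ⟨?_, ?_⟩).symm⟩
  · intro a b hab
    have h := e.symm.injective (congrArg Subtype.val hab)
    exact (Prod.ext_iff.1 h).2
  · rintro ⟨g, hg⟩
    have h : IsOfFinAddOrder (e g).1 :=
      AddMonoidHom.isOfFinAddOrder ((AddMonoidHom.fst ℤ Q).comp e.toAddMonoidHom) hg
    have h0 : (e g).1 = 0 := h.eq_zero'
    refine ⟨(e g).2, Subtype.ext ?_⟩
    exact (e.symm_apply_eq).2 (Prod.ext h0.symm rfl)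

end Isomorphism

end RookRelations

/-- The critical group of the rook's graph (the torsion subgroup of the cokernel of the
Laplacian over `ℤ`) is `(ℤ/2n)^{(n-2)²+1} ⊕ (ℤ/2n²)^{2(n-2)}`. -/
theorem rook_critical_group (n : ℕ) (hn : 3 ≤ n) :
    Nonempty
      ((AddCommGroup.torsion ((Fin n × Fin n → ℤ) ⧸ LinearMap.range (rookLap n).mulVecLin)) ≃+
        ((Fin ((n - 2) ^ 2 + 1) → ZMod (2 * n)) × (Fin (2 * (n - 2)) → ZMod (2 * n ^ 2)))) := by
  obtain ⟨k, rfl⟩ : ∃ k, n = k + 2 := ⟨n - 2, by omega⟩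
  obtain ⟨e⟩ := RookRelations.nonempty_cokernel_equiv k
  have : NeZero (2 * (k + 2)) := ⟨by positivity⟩
  have : NeZero (2 * (k + 2) ^ 2) := ⟨by positivity⟩
  obtain ⟨f⟩ := RookRelations.nonempty_torsion_equiv (isAddTorsion_of_finite) e
  have σ : Option (Fin k × Fin k) ≃ Fin ((k + 2 - 2) ^ 2 + 1) :=
    Fintype.equivOfCardEq (by simp [sq])
  have τ : Fin k ⊕ Fin k ≃ Fin (2 * (k + 2 - 2)) := Fintype.equivOfCardEq (by simp [two_mul])
  exact ⟨f.trans (AddEquiv.prodCongr (AddEquiv.arrowCongr σ (AddEquiv.refl _))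
    (AddEquiv.arrowCongr τ (AddEquiv.refl _)))⟩
end

section
/- For n ≥ 3, the critical group of the complement of the n×n rook's graph is isomorphic to (Z/n(n-2))^{(n-2)²-1} ⊕ (Z/n(n-1)(n-2))² ⊕ (Z/n²(n-1)(n-2))^{2(n-2)}. -/
/-- The sum of the `i`-th row of a square array. -/
def rowSum {n : ℕ} (v : Fin n × Fin n → ℤ) (i : Fin n) : ℤ := ∑ j, v (i, j)

/-- The sum of the `j`-th column of a square array. -/
def colSum {n : ℕ} (v : Fin n × Fin n → ℤ) (j : Fin n) : ℤ := ∑ i, v (i, j)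

/-- The sum of all entries of a square array. -/
def totalSum {n : ℕ} (v : Fin n × Fin n → ℤ) : ℤ := ∑ i, rowSum v i

theorem totalSum_eq_sum_colSum {n : ℕ} (v : Fin n × Fin n → ℤ) :
    totalSum v = ∑ j, colSum v j := by
  simp only [totalSum, rowSum, colSum]
  exact Finset.sum_comm

theorem rowSum_add {n : ℕ} (v w : Fin n × Fin n → ℤ) (i : Fin n) :
    rowSum (v + w) i = rowSum v i + rowSum w i := by
  simp [rowSum, Finset.sum_add_distrib]

theorem colSum_add {n : ℕ} (v w : Fin n × Fin n → ℤ) (j : Fin n) :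
    colSum (v + w) j = colSum v j + colSum w j := by
  simp [colSum, Finset.sum_add_distrib]

theorem totalSum_add {n : ℕ} (v w : Fin n × Fin n → ℤ) :
    totalSum (v + w) = totalSum v + totalSum w := by
  simp [totalSum, rowSum_add, Finset.sum_add_distrib]

/-- A square array is determined by its entries outside the last row and column, the
corresponding row and column sums, and the sum of all entries. -/
theorem square_array_ext {k : ℕ} {v w : Fin (k + 1) × Fin (k + 1) → ℤ}
    (total : totalSum v = totalSum w)
    (row : ∀ i : Fin k, rowSum v i.castSucc = rowSum w i.castSucc)
    (col : ∀ j : Fin k, colSum v j.castSucc = colSum w j.castSucc)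
    (entry : ∀ i j : Fin k, v (i.castSucc, j.castSucc) = w (i.castSucc, j.castSucc)) :
    v = w := by
  have lastCol (i : Fin k) : v (i.castSucc, Fin.last k) = w (i.castSucc, Fin.last k) := by
    have h := row i
    simp only [rowSum, Fin.sum_univ_castSucc, entry] at h
    linarith
  have lastRow (j : Fin k) : v (Fin.last k, j.castSucc) = w (Fin.last k, j.castSucc) := by
    have h := col j
    simp only [colSum, Fin.sum_univ_castSucc, entry] at h
    linarith
  have corner : v (Fin.last k, Fin.last k) = w (Fin.last k, Fin.last k) := by
    simp only [totalSum, rowSum, Fin.sum_univ_castSucc, entry, lastCol, lastRow] at total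
    linarith
  ext ⟨i, j⟩
  refine Fin.lastCases ?_ (fun i => ?_) i <;> refine Fin.lastCases ?_ (fun j => ?_) j
  · exact corner
  · exact lastRow j
  · exact lastCol i
  · exact entry i j

/-- The entries outside the last row and column, the corresponding row and column sums, and
the sum of all entries of a square array can be prescribed freely. -/
theorem exists_square_array {k : ℕ} (s : ℤ) (r c : Fin k → ℤ) (x : Fin k → Fin k → ℤ) :
    ∃ v : Fin (k + 1) × Fin (k + 1) → ℤ, totalSum v = s ∧
      (∀ i : Fin k, rowSum v i.castSucc = r i) ∧
      (∀ j : Fin k, colSum v j.castSucc = c j) ∧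
      ∀ i j : Fin k, v (i.castSucc, j.castSucc) = x i j := by
  refine ⟨fun p => Fin.lastCases (motive := fun _ => ℤ)
    (Fin.lastCases (motive := fun _ => ℤ) (s - ∑ i, r i - ∑ j, (c j - ∑ i, x i j))
      (fun j => c j - ∑ i, x i j) p.2)
    (fun i => Fin.lastCases (motive := fun _ => ℤ) (r i - ∑ j, x i j) (fun j => x i j) p.2)
    p.1, ?_, ?_, ?_, ?_⟩
  · simp [totalSum, rowSum, Fin.sum_univ_castSucc]
  · simp [rowSum, Fin.sum_univ_castSucc]
  · simp [colSum, Fin.sum_univ_castSucc]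
  · simp

theorem rookcAdj_apply {n : ℕ} (u v : Fin n × Fin n) :
    rookcAdj n u v =
      (1 - (1 : Matrix (Fin n) (Fin n) ℤ) u.1 v.1) *
        (1 - (1 : Matrix (Fin n) (Fin n) ℤ) u.2 v.2) := by
  obtain ⟨i, j⟩ := u
  obtain ⟨i', j'⟩ := v
  by_cases hi : i = i' <;> by_cases hj : j = j' <;> simp [rookcAdj, Matrix.one_apply, hi, hj]

theorem sum_rookcAdj_mul {n : ℕ} (x : Fin n × Fin n → ℤ) (u : Fin n × Fin n) :
    ∑ v, rookcAdj n u v * x v = totalSum x - rowSum x u.1 - colSum x u.2 + x u := by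
  obtain ⟨i, j⟩ := u
  have h (a b : Fin n) : rookcAdj n (i, j) (a, b) * x (a, b) =
      x (a, b) - (if i = a then x (a, b) else 0) - (if j = b then x (a, b) else 0)
        + (if i = a then if j = b then x (a, b) else 0 else 0) := by
    rw [rookcAdj_apply]
    simp only [Matrix.one_apply]
    split_ifs <;> ring
  rw [Fintype.sum_prod_type]
  simp [h, Finset.sum_add_distrib, Finset.sum_sub_distrib, totalSum, rowSum, colSum,
    Finset.sum_ite_irrel]

theorem rookcLap_mulVec_apply {n : ℕ} (x : Fin n × Fin n → ℤ) (u : Fin n × Fin n) :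
    (rookcLap n).mulVec x u =
      n * (n - 2) * x u + rowSum x u.1 + colSum x u.2 - totalSum x := by
  have degree : ∑ v, rookcAdj n u v = (n : ℤ) * n - n - n + 1 := by
    have h := sum_rookcAdj_mul (fun _ => 1) u
    simpa [totalSum, rowSum, colSum] using h
  rw [rookcLap, Matrix.sub_mulVec, Pi.sub_apply, Matrix.mulVec_diagonal, degree]
  simp only [Matrix.mulVec, dotProduct, sum_rookcAdj_mul]
  ring

theorem rowSum_rookcLap_mulVec {n : ℕ} (x : Fin n × Fin n → ℤ) (i : Fin n) :
    rowSum ((rookcLap n).mulVec x) i = (n - 1) * (n * rowSum x i - totalSum x) := by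
  have h : rowSum ((rookcLap n).mulVec x) i =
      n * (n - 2) * rowSum x i + n * rowSum x i + totalSum x - n * totalSum x := by
    simp only [rowSum, rookcLap_mulVec_apply, Finset.sum_add_distrib, Finset.sum_sub_distrib,
      ← Finset.mul_sum, ← totalSum_eq_sum_colSum]
    simp
  rw [h]
  ring

theorem colSum_rookcLap_mulVec {n : ℕ} (x : Fin n × Fin n → ℤ) (j : Fin n) :
    colSum ((rookcLap n).mulVec x) j = (n - 1) * (n * colSum x j - totalSum x) := by
  have h : colSum ((rookcLap n).mulVec x) j =
      n * (n - 2) * colSum x j + totalSum x + n * colSum x j - n * totalSum x := by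
    simp only [colSum, rookcLap_mulVec_apply, Finset.sum_add_distrib, Finset.sum_sub_distrib,
      ← Finset.mul_sum]
    simp [totalSum]
  rw [h]
  ring

theorem totalSum_rookcLap_mulVec {n : ℕ} (x : Fin n × Fin n → ℤ) :
    totalSum ((rookcLap n).mulVec x) = 0 := by
  rw [totalSum]
  simp only [rowSum_rookcLap_mulVec, ← Finset.mul_sum, Finset.sum_sub_distrib]
  simp [totalSum]

/-- The finite abelian group given by the diagonal form of the Laplacian of the complement of
the `(q + 2) × (q + 2)` rook's graph, before the coprime factors are combined. -/
abbrev RookcDiagonalGroup (q : ℕ) : Type :=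
  (Fin q × Fin q → ZMod ((q + 2) * q)) × ZMod (q + 1) × ZMod ((q + 1) * ((q + 2) * q)) ×
    (Fin q → ZMod ((q + 2) * (q + 1) * ((q + 2) * q))) ×
    (Fin q → ZMod ((q + 2) * (q + 1) * ((q + 2) * q)))

/-- A homomorphism whose kernel is the lattice spanned by the Laplacian of the complement of
the rook's graph. -/
def rookcDiagonalHom (q : ℕ) :
    (Fin (q + 2) × Fin (q + 2) → ℤ) →+ ℤ × RookcDiagonalGroup q :=
  AddMonoidHom.mk' (fun v =>
    (totalSum v,
      fun p => ((v (p.1.succ.castSucc, p.2.succ.castSucc) - v (p.1.succ.castSucc, 0)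
        - v (0, p.2.succ.castSucc) + v (0, 0) : ℤ) : ZMod _),
      ((colSum v 0 : ℤ) : ZMod _),
      ((rowSum v 0 + (q + 1) * colSum v 0 - (q + 2) * (q + 1) * v (0, 0) : ℤ) : ZMod _),
      fun i => ((rowSum v i.succ.castSucc - rowSum v 0
        - (q + 2) * (q + 1) * (v (i.succ.castSucc, 0) - v (0, 0)) : ℤ) : ZMod _),
      fun j => ((colSum v j.succ.castSucc - colSum v 0
        - (q + 2) * (q + 1) * (v (0, j.succ.castSucc) - v (0, 0)) : ℤ) : ZMod _)))
    (fun v w => by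
      simp only [totalSum_add, rowSum_add, colSum_add, Pi.add_apply, Prod.mk_add_mk]
      refine Prod.ext rfl (Prod.ext (funext fun p => ?_) (Prod.ext ?_ (Prod.ext ?_
        (Prod.ext (funext fun i => ?_) (funext fun j => ?_))))) <;>
      simp only [Pi.add_apply, ← Int.cast_add] <;> congr 1 <;> ring)

theorem rookcDiagonalHom_eq_zero_iff {q : ℕ} (v : Fin (q + 2) × Fin (q + 2) → ℤ) :
    rookcDiagonalHom q v = 0 ↔
      totalSum v = 0 ∧
      (∀ i j : Fin q, ((q : ℤ) + 2) * q ∣ v (i.succ.castSucc, j.succ.castSucc)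
        - v (i.succ.castSucc, 0) - v (0, j.succ.castSucc) + v (0, 0)) ∧
      (q : ℤ) + 1 ∣ colSum v 0 ∧
      ((q : ℤ) + 1) * ((q + 2) * q) ∣
        rowSum v 0 + (q + 1) * colSum v 0 - (q + 2) * (q + 1) * v (0, 0) ∧
      (∀ i : Fin q, ((q : ℤ) + 2) * (q + 1) * ((q + 2) * q) ∣ rowSum v i.succ.castSucc
        - rowSum v 0 - (q + 2) * (q + 1) * (v (i.succ.castSucc, 0) - v (0, 0))) ∧
      ∀ j : Fin q, ((q : ℤ) + 2) * (q + 1) * ((q + 2) * q) ∣ colSum v j.succ.castSucc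
        - colSum v 0 - (q + 2) * (q + 1) * (v (0, j.succ.castSucc) - v (0, 0)) := by
  simp only [rookcDiagonalHom, AddMonoidHom.mk'_apply, Prod.ext_iff, funext_iff, Prod.fst_zero,
    Prod.snd_zero, Pi.zero_apply, ZMod.intCast_zmod_eq_zero_iff_dvd, Prod.forall]
  push_cast
  rfl

theorem rookcDiagonalHom_surjective (q : ℕ) : Function.Surjective (rookcDiagonalHom q) := by
  rintro ⟨s, y, c₀, r₀, r, c⟩
  choose y' hy using fun p => ZMod.intCast_surjective (y p)
  obtain ⟨c₀', rfl⟩ := ZMod.intCast_surjective c₀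
  obtain ⟨r₀', rfl⟩ := ZMod.intCast_surjective r₀
  choose r' hr using fun i => ZMod.intCast_surjective (r i)
  choose c' hc using fun j => ZMod.intCast_surjective (c j)
  obtain ⟨v, total, row, col, entry⟩ := exists_square_array (k := q + 1) s
    (Fin.cons (r₀' - (q + 1) * c₀') fun i => r' i + (r₀' - (q + 1) * c₀'))
    (Fin.cons c₀' fun j => c' j + c₀')
    (Fin.cons 0 fun i => Fin.cons 0 fun j => y' (i, j))
  have row₀ := row 0
  have col₀ := col 0
  have entry₀ := entry 0 0
  have entry₁ (i : Fin q) := entry i.succ 0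
  have entry₂ (j : Fin q) := entry 0 j.succ
  simp only [Fin.castSucc_zero, Fin.cons_zero, Fin.cons_succ, Pi.zero_apply]
    at row₀ col₀ entry₀ entry₁ entry₂
  refine ⟨v, ?_⟩
  simp only [rookcDiagonalHom, AddMonoidHom.mk'_apply, total, row, col, entry, row₀, col₀, entry₀,
    entry₁, entry₂, Fin.cons_succ]
  refine Prod.ext rfl (Prod.ext (funext fun p => ?_) (Prod.ext rfl (Prod.ext ?_
    (Prod.ext (funext fun i => ?_) (funext fun j => ?_)))))
  · simp [← hy]
  · simp
  · simp [← hr]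
  · simp [← hc]

theorem rookcDiagonalHom_rookcLap_mulVec {q : ℕ} (x : Fin (q + 2) × Fin (q + 2) → ℤ) :
    rookcDiagonalHom q ((rookcLap (q + 2)).mulVec x) = 0 := by
  rw [rookcDiagonalHom_eq_zero_iff]
  simp only [rowSum_rookcLap_mulVec, colSum_rookcLap_mulVec, totalSum_rookcLap_mulVec,
    rookcLap_mulVec_apply, true_and]
  push_cast
  refine ⟨fun i j => ⟨x (i.succ.castSucc, j.succ.castSucc) - x (i.succ.castSucc, 0)
      - x (0, j.succ.castSucc) + x (0, 0), by ring⟩,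
    ⟨(q + 2) * colSum x 0 - totalSum x, by ring⟩,
    ⟨colSum x 0 - (q + 2) * x (0, 0), by ring⟩,
    fun i => ⟨x (0, 0) - x (i.succ.castSucc, 0), by ring⟩,
    fun j => ⟨x (0, 0) - x (0, j.succ.castSucc), by ring⟩⟩

theorem exists_rookcLap_mulVec_eq {q : ℕ} {v : Fin (q + 2) × Fin (q + 2) → ℤ}
    (hv : rookcDiagonalHom q v = 0) : ∃ x, (rookcLap (q + 2)).mulVec x = v := by
  obtain ⟨total, entry, ⟨w, hw⟩, ⟨u, hu⟩, row, col⟩ := (rookcDiagonalHom_eq_zero_iff v).1 hv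
  choose z hz using entry
  choose a ha using row
  choose b hb using col
  have row₀ : rowSum v 0 = (q + 1) * ((q + 2) * v (0, 0) + (q + 2) * q * u - (q + 1) * w) := by
    linear_combination hu - (q + 1) * hw
  let r₀ : ℤ := v (0, 0) + (q + 1) * u - w
  obtain ⟨x, xtotal, xrow, xcol, xentry⟩ := exists_square_array (k := q + 1) ((q + 2) * u - w)
    (Fin.cons r₀ fun i => r₀ + v (i.succ.castSucc, 0) - v (0, 0) + (q + 2) * q * a i)
    (Fin.cons u fun j => u + v (0, j.succ.castSucc) - v (0, 0) + (q + 2) * q * b j)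
    (Fin.cons (Fin.cons 0 fun j => - b j) fun i => Fin.cons (- a i) fun j => z i j - a i - b j)
  refine ⟨x, square_array_ext ?_ ?_ ?_ ?_⟩
  · rw [totalSum_rookcLap_mulVec, total]
  · intro i
    rw [rowSum_rookcLap_mulVec, xrow, xtotal]
    refine Fin.cases ?_ (fun i => ?_) i
    · simp only [Fin.cons_zero, Fin.castSucc_zero, row₀, r₀]
      push_cast
      ring
    · simp only [Fin.cons_succ, r₀]
      push_cast
      linear_combination -ha i - row₀
  · intro j
    rw [colSum_rookcLap_mulVec, xcol, xtotal]
    refine Fin.cases ?_ (fun j => ?_) j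
    · simp only [Fin.cons_zero, Fin.castSucc_zero, hw]
      push_cast
      ring
    · simp only [Fin.cons_succ]
      push_cast
      linear_combination -hb j - hw
  · intro i j
    rw [rookcLap_mulVec_apply, xrow, xcol, xtotal, xentry]
    refine Fin.cases ?_ (fun i => ?_) i <;> refine Fin.cases ?_ (fun j => ?_) j <;>
      simp only [Fin.cons_zero, Fin.cons_succ, Fin.castSucc_zero, r₀] <;> push_cast
    · ring
    · ring
    · ring
    · linear_combination -hz i j

/-- The cokernel of the Laplacian of the complement of the `(q + 2) × (q + 2)` rook's graph. -/
noncomputable def rookcCokernelEquiv (q : ℕ) :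
    ((Fin (q + 2) × Fin (q + 2) → ℤ) ⧸ LinearMap.range (rookcLap (q + 2)).mulVecLin) ≃+
      ℤ × RookcDiagonalGroup q :=
  have range_eq_ker : LinearMap.range (rookcLap (q + 2)).mulVecLin =
      LinearMap.ker (rookcDiagonalHom q).toIntLinearMap := by
    ext v
    constructor
    · rintro ⟨x, rfl⟩
      exact rookcDiagonalHom_rookcLap_mulVec x
    · exact fun hv => exists_rookcLap_mulVec_eq hv
  ((Submodule.quotEquivOfEq _ _ range_eq_ker).trans
    ((rookcDiagonalHom q).toIntLinearMap.quotKerEquivOfSurjective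
      (rookcDiagonalHom_surjective q))).toAddEquiv

/-- The torsion subgroup of a group isomorphic to `ℤ × T` with `T` finite is isomorphic
to `T`. -/
noncomputable def torsionEquivOfEquivIntProd {A T : Type*} [AddCommGroup A] [AddCommGroup T]
    [Finite T] (e : A ≃+ ℤ × T) : AddCommGroup.torsion A ≃+ T :=
  AddEquiv.ofBijective
    (((AddMonoidHom.snd ℤ T).comp e.toAddMonoidHom).comp (AddCommGroup.torsion A).subtype) <| by
    constructor
    · rw [injective_iff_map_eq_zero]
      rintro ⟨a, ha⟩ h
      have hfst : IsOfFinAddOrder (e a).1 :=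
        ((AddMonoidHom.fst ℤ T).comp e.toAddMonoidHom).isOfFinAddOrder ha
      rw [Subtype.ext_iff]
      refine (map_eq_zero_iff e e.injective).1 (Prod.ext ?_ h)
      obtain ⟨m, hm, hma⟩ := isOfFinAddOrder_iff_nsmul_eq_zero.1 hfst
      simpa [hm.ne'] using hma
    · intro t
      refine ⟨⟨e.symm (0, t), ?_⟩, by simp⟩
      exact (e.symm.toAddMonoidHom.comp (AddMonoidHom.inr ℤ T)).isOfFinAddOrder
        (isOfFinAddOrder_of_finite t)

/-- Regrouping of a product of powers of additive groups. -/
theorem nonempty_regroup_equiv {R S P Q : Type*} [AddCommGroup R] [AddCommGroup S]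
    [AddCommGroup P] [AddCommGroup Q] {q : ℕ} (hq : 0 < q) (e : R × S ≃+ P) :
    Nonempty (((Fin q × Fin q → R) × S × P × (Fin q → Q) × (Fin q → Q)) ≃+
      ((Fin (q ^ 2 - 1) → R) × (Fin 2 → P) × (Fin (2 * q) → Q))) := by
  have card_square : Fintype.card (Fin q × Fin q) = Fintype.card (Option (Fin (q ^ 2 - 1))) := by
    have := Nat.pow_pos (n := 2) hq
    simp only [Fintype.card_prod, Fintype.card_option, Fintype.card_fin, ← sq]
    omega
  have card_double : Fintype.card (Fin q ⊕ Fin q) = Fintype.card (Fin (2 * q)) := by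
    simp [two_mul]
  let square : (Fin q × Fin q → R) ≃+ R × (Fin (q ^ 2 - 1) → R) :=
    ((LinearEquiv.funCongrLeft ℤ R (Fintype.equivOfCardEq card_square).symm).trans
      (LinearEquiv.piOptionEquivProd ℤ)).toAddEquiv
  let pair : (P × P) ≃+ (Fin 2 → P) := (LinearEquiv.finTwoArrow ℤ P).symm.toAddEquiv
  let double : ((Fin q → Q) × (Fin q → Q)) ≃+ (Fin (2 * q) → Q) :=
    ((LinearEquiv.sumArrowLequivProdArrow (Fin q) (Fin q) ℤ Q).symm.trans
      (LinearEquiv.funCongrLeft ℤ Q (Fintype.equivOfCardEq card_double).symm)).toAddEquiv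
  let regroup : ((R × (Fin (q ^ 2 - 1) → R)) × S × P × (Fin q → Q) × (Fin q → Q)) ≃+
      ((Fin (q ^ 2 - 1) → R) × ((R × S) × P) × (Fin q → Q) × (Fin q → Q)) :=
    { toFun := fun x => (x.1.2, ((x.1.1, x.2.1), x.2.2.1), x.2.2.2)
      invFun := fun x => ((x.2.1.1.1, x.1), x.2.1.1.2, x.2.1.2, x.2.2)
      left_inv := fun _ => rfl
      right_inv := fun _ => rfl
      map_add' := fun _ _ => rfl }
  exact ⟨((square.prodCongr (.refl _)).trans regroup).trans
    ((AddEquiv.refl _).prodCongr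
      (((e.prodCongr (.refl P)).trans pair).prodCongr double))⟩

/-- Combination of the coprime cyclic factors of the diagonal form. -/
theorem nonempty_rookcDiagonalGroup_equiv {q : ℕ} (hq : 0 < q) :
    Nonempty (RookcDiagonalGroup q ≃+
      ((Fin (q ^ 2 - 1) → ZMod ((q + 2) * q)) ×
        (Fin 2 → ZMod ((q + 2) * (q + 1) * q)) ×
        (Fin (2 * q) → ZMod ((q + 2) ^ 2 * (q + 1) * q)))) := by
  have coprime : Nat.Coprime ((q + 2) * q) (q + 1) :=
    Nat.Coprime.mul_left (by rw [show q + 2 = q + 1 + 1 by rfl]; simp) (by simp)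
  have chinese := (ZMod.chineseRemainder coprime).symm.toAddEquiv
  rw [show (q + 2) * (q + 1) * q = (q + 2) * q * (q + 1) by ring,
    show (q + 2) ^ 2 * (q + 1) * q = (q + 2) * (q + 1) * ((q + 2) * q) by ring]
  unfold RookcDiagonalGroup
  rw [mul_comm (q + 1)]
  exact nonempty_regroup_equiv hq chinese

/-- The critical group of the complement of the rook's graph is
`(ℤ/n(n-2))^{(n-2)²-1} ⊕ (ℤ/n(n-1)(n-2))² ⊕ (ℤ/n²(n-1)(n-2))^{2(n-2)}`. -/
theorem rook_compl_critical_group (n : ℕ) (hn : 3 ≤ n) :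
    Nonempty
      ((AddCommGroup.torsion ((Fin n × Fin n → ℤ) ⧸ LinearMap.range (rookcLap n).mulVecLin)) ≃+
        ((Fin ((n - 2) ^ 2 - 1) → ZMod (n * (n - 2))) ×
          (Fin 2 → ZMod (n * (n - 1) * (n - 2))) ×
          (Fin (2 * (n - 2)) → ZMod (n ^ 2 * (n - 1) * (n - 2))))) := by
  obtain ⟨q, rfl⟩ : ∃ q, n = q + 2 := ⟨n - 2, by omega⟩
  have : NeZero q := ⟨by omega⟩
  obtain ⟨e⟩ := nonempty_rookcDiagonalGroup_equiv (q := q) (by omega)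
  exact ⟨(torsionEquivOfEquivIntProd (rookcCokernelEquiv q)).trans e⟩
end
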